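/- Let L, d, V be positive natural numbers, let κ ≥ 0 and D_max ≥ 0, and let f be a function from embedding matrices (functions from Fin L to ℝ^d) to logit matrices (functions from Fin L to ℝ^V) that is Lipschitz with constant κ/L with respect to the Frobenius norms. Let M ⊆ Fin L (the masked positions) with m = |M|, let R ⊆ M be nonempty with M \ R nonempty, and let E, E' be embedding matrices agreeing on every row outside R with ‖E' j − E j‖₂ ≤ D_max for every j ∈ R. Then the average one-step total variation change over the remaining masked positions satisfies (1 / |M \ R|) · ∑_{i ∈ M \ R} D_TV(softmax((f E') i), softmax((f E) i)) ≤ κ · D_max · m / L. -/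

import Mathlib

/-- Softmax of a vector of logits. -/
noncomputable def softmax {V : ℕ} (x : Fin V → ℝ) : Fin V → ℝ :=
  fun i => Real.exp (x i) / ∑ j, Real.exp (x j)

/-- Total variation distance between two vectors, `(1/2) · ∑ i |p i − q i|`. -/
noncomputable def tvDist {V : ℕ} (p q : Fin V → ℝ) : ℝ :=
  (1 / 2) * ∑ i, |p i - q i|

/-- Euclidean (ℓ2) norm of a vector. -/
noncomputable def l2norm {d : ℕ} (v : Fin d → ℝ) : ℝ :=
  Real.sqrt (∑ k, (v k) ^ 2)

/-- Frobenius (entrywise ℓ2) norm of a matrix. -/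
noncomputable def frobNorm {L d : ℕ} (M : Fin L → Fin d → ℝ) : ℝ :=
  Real.sqrt (∑ j, ∑ k, (M j k) ^ 2)

theorem abs_le_frobNorm {L d : ℕ} (A : Fin L → Fin d → ℝ) (j : Fin L) (k : Fin d) :
    |A j k| ≤ frobNorm A := by
  refine Real.abs_le_sqrt ?_
  calc A j k ^ 2 ≤ ∑ k, A j k ^ 2 :=
        Finset.single_le_sum (f := fun k => A j k ^ 2) (fun _ _ => sq_nonneg _)
          (Finset.mem_univ k)
    _ ≤ ∑ j, ∑ k, A j k ^ 2 :=
        Finset.single_le_sum (f := fun j => ∑ k, A j k ^ 2)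
          (fun _ _ => Finset.sum_nonneg fun _ _ => sq_nonneg _) (Finset.mem_univ j)

theorem frobNorm_le_sqrt_card_mul {L d : ℕ} {A : Fin L → Fin d → ℝ} {R : Finset (Fin L)} {c : ℝ}
    (hc : 0 ≤ c) (hzero : ∀ j ∉ R, A j = 0) (hrow : ∀ j ∈ R, l2norm (A j) ≤ c) :
    frobNorm A ≤ √(R.card : ℝ) * c := by
  have hsum : ∑ j, ∑ k, A j k ^ 2 = ∑ j ∈ R, ∑ k, A j k ^ 2 :=
    (Finset.sum_subset (Finset.subset_univ R) fun j _ hj => by simp [hzero j hj]).symm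
  refine Real.sqrt_le_iff.2 ⟨by positivity, ?_⟩
  rw [hsum, mul_pow, Real.sq_sqrt (Nat.cast_nonneg _), ← nsmul_eq_mul]
  exact Finset.sum_le_card_nsmul _ _ _ fun j hj => (Real.sqrt_le_iff.1 (hrow j hj)).2

theorem softmax_nonneg {V : ℕ} (x : Fin V → ℝ) (i : Fin V) : 0 ≤ softmax x i := by
  unfold softmax
  positivity

theorem sum_softmax_le_one {V : ℕ} (x : Fin V → ℝ) : ∑ i, softmax x i ≤ 1 := by
  simp only [softmax, ← Finset.sum_div]
  exact div_self_le_one _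

theorem softmax_le_exp_mul_softmax {V : ℕ} {x y : Fin V → ℝ} {t : ℝ}
    (h : ∀ j, |x j - y j| ≤ t) (i : Fin V) :
    softmax x i ≤ Real.exp (2 * t) * softmax y i := by
  have hpos (z : Fin V → ℝ) : 0 < ∑ j, Real.exp (z j) :=
    Finset.sum_pos (fun _ _ => Real.exp_pos _) ⟨i, Finset.mem_univ i⟩
  have hnum : Real.exp (x i) ≤ Real.exp t * Real.exp (y i) := by
    rw [← Real.exp_add, Real.exp_le_exp]
    linarith [(abs_le.1 (h i)).2]
  have hden : ∑ j, Real.exp (y j) ≤ Real.exp t * ∑ j, Real.exp (x j) := by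
    rw [Finset.mul_sum]
    refine Finset.sum_le_sum fun j _ => ?_
    rw [← Real.exp_add, Real.exp_le_exp]
    linarith [(abs_le.1 (h j)).1]
  unfold softmax
  rw [← mul_div_assoc, div_le_div_iff₀ (hpos x) (hpos y)]
  calc Real.exp (x i) * ∑ j, Real.exp (y j)
      ≤ (Real.exp t * Real.exp (y i)) * (Real.exp t * ∑ j, Real.exp (x j)) :=
        mul_le_mul hnum hden (hpos y).le (by positivity)
    _ = Real.exp (2 * t) * Real.exp (y i) * ∑ j, Real.exp (x j) := by
        rw [two_mul, Real.exp_add]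
        ring

theorem softmax_sub_softmax_le {V : ℕ} {x y : Fin V → ℝ} {t : ℝ}
    (h : ∀ j, |x j - y j| ≤ t) (i : Fin V) :
    softmax x i - softmax y i ≤ 2 * t * softmax x i := by
  have hexp : Real.exp (-(2 * t)) * softmax x i ≤ softmax y i := by
    rw [Real.exp_neg, inv_mul_le_iff₀ (Real.exp_pos _)]
    exact softmax_le_exp_mul_softmax h i
  have hlin := mul_le_mul_of_nonneg_right (Real.add_one_le_exp (-(2 * t))) (softmax_nonneg x i)
  linarith

theorem tvDist_softmax_le {V : ℕ} {x y : Fin V → ℝ} {t : ℝ} (ht : 0 ≤ t)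
    (h : ∀ j, |x j - y j| ≤ t) : tvDist (softmax x) (softmax y) ≤ 2 * t := by
  have hpt (i : Fin V) :
      |softmax x i - softmax y i| ≤ 2 * t * (softmax x i + softmax y i) := by
    have hxy := softmax_sub_softmax_le h i
    have hyx := softmax_sub_softmax_le (fun j => abs_sub_comm (x j) (y j) ▸ h j) i
    have hx := mul_nonneg ht (softmax_nonneg x i)
    have hy := mul_nonneg ht (softmax_nonneg y i)
    exact abs_le.2 ⟨by linarith, by linarith⟩
  have hsum : ∑ i, |softmax x i - softmax y i| ≤ 2 * t * 2 :=
    calc ∑ i, |softmax x i - softmax y i|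
        ≤ ∑ i, 2 * t * (softmax x i + softmax y i) := Finset.sum_le_sum fun i _ => hpt i
      _ = 2 * t * (∑ i, softmax x i + ∑ i, softmax y i) := by
          rw [← Finset.mul_sum, Finset.sum_add_distrib]
      _ ≤ 2 * t * 2 := by
          gcongr
          linarith [sum_softmax_le_one x, sum_softmax_le_one y]
  unfold tvDist
  linarith

/-- Corollary 1 (cumulative residual decay), quantitative form: the average one-step
total variation change over the remaining masked positions `M \ R` is at most
`κ · D_max · m / L` where `m = |M|`. -/
theorem cumulative_residual_decay {L d V : ℕ} (hL : 0 < L) (hd : 0 < d) (hV : 0 < V)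
    (κ Dmax : ℝ) (hκ : 0 ≤ κ) (hD : 0 ≤ Dmax)
    (f : (Fin L → Fin d → ℝ) → (Fin L → Fin V → ℝ))
    (hf : ∀ A B : Fin L → Fin d → ℝ,
      frobNorm (fun j k => f B j k - f A j k) ≤ (κ / L) * frobNorm (fun j k => B j k - A j k))
    (M R : Finset (Fin L)) (hRM : R ⊆ M) (hR : R.Nonempty) (hMR : (M \ R).Nonempty)
    (E E' : Fin L → Fin d → ℝ)
    (hagree : ∀ j ∉ R, E' j = E j)
    (hbound : ∀ j ∈ R, l2norm (fun k => E' j k - E j k) ≤ Dmax) :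
    (1 / ((M \ R).card : ℝ)) *
        ∑ i ∈ M \ R, tvDist (softmax (f E' i)) (softmax (f E i)) ≤
      κ * Dmax * (M.card : ℝ) / L := by
  have hfrob : frobNorm (fun j k => E' j k - E j k) ≤ √(R.card : ℝ) * Dmax :=
    frobNorm_le_sqrt_card_mul hD (fun j hj => by ext k; simp [hagree j hj]) hbound
  have hcard : 2 * √(R.card : ℝ) ≤ M.card := by
    have hle : (R.card : ℝ) + 1 ≤ M.card := by
      have hpos := hMR.card_pos
      have hadd := Finset.card_sdiff_add_card_eq_card hRM
      exact_mod_cast (by lia : R.card + 1 ≤ M.card)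
    nlinarith [sq_nonneg (√(R.card : ℝ) - 1), Real.sq_sqrt (Nat.cast_nonneg (α := ℝ) R.card)]
  have htv : ∀ i ∈ M \ R, tvDist (softmax (f E' i)) (softmax (f E i)) ≤
      2 * frobNorm (fun j k => f E' j k - f E j k) := fun i _ =>
    tvDist_softmax_le (Real.sqrt_nonneg _) (abs_le_frobNorm (fun j k => f E' j k - f E j k) i)
  have hsum := Finset.sum_le_card_nsmul _ _ _ htv
  rw [nsmul_eq_mul] at hsum
  rw [one_div, inv_mul_le_iff₀ (Nat.cast_pos.2 hMR.card_pos)]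
  refine hsum.trans (mul_le_mul_of_nonneg_left ?_ (Nat.cast_nonneg _))
  calc 2 * frobNorm (fun j k => f E' j k - f E j k)
      ≤ 2 * (κ / L * (√(R.card : ℝ) * Dmax)) := by
        gcongr
        exact (hf E E').trans (by gcongr)
    _ = κ / L * Dmax * (2 * √(R.card : ℝ)) := by ring
    _ ≤ κ / L * Dmax * M.card := by gcongr
    _ = κ * Dmax * M.card / L := by ring
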